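/- Let θ* ∈ ℝ^p be a nonincreasing nonnegative threshold vector and let (β̂, ẑ) ∈ ℝ^p × ℝ^n be a stationary point of the SLOPE AMP iteration with thresholds θ*, i.e., β̂ = prox_{J_{θ*}}(β̂ + Xᵀẑ) and ẑ = y − Xβ̂ + (ẑ/n)‖prox_{J_{θ*}}(β̂ + Xᵀẑ)‖₀*, and assume ‖prox_{J_{θ*}}(β̂ + Xᵀẑ)‖₀* < n. Then β̂ is a minimizer of the SLOPE cost b ↦ (1/2)‖y − Xb‖² + J_λ(b) with regularization parameter λ = θ*·(1 − (1/n)‖prox_{J_{θ*}}(β̂ + Xᵀẑ)‖₀*). -/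

import Mathlib

open MeasureTheory ProbabilityTheory Filter
open scoped Classical ENNReal NNReal

noncomputable section

/-- squared Euclidean norm of a vector in `ℝ^m`. -/
def sqnorm {m : ℕ} (v : Fin m → ℝ) : ℝ := ∑ i, (v i) ^ 2

/-- Sorted ℓ1 norm `J_λ(b) = ∑ λ_i |b|_(i)` : for a nonincreasing nonnegative `lam`
this supremum over permutations equals the inner product of `lam` with the decreasingly
sorted absolute values of `b` (rearrangement inequality). -/
def sortedL1 {p : ℕ} (lam b : Fin p → ℝ) : ℝ :=
  ⨆ σ : Equiv.Perm (Fin p), ∑ i, lam i * |b (σ i)|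

/-- `b` is the proximal point of the sorted ℓ1 norm with threshold `θ` at `x`. -/
def IsProx {p : ℕ} (θ x b : Fin p → ℝ) : Prop :=
  ∀ c : Fin p → ℝ,
    (1 / 2) * sqnorm (x - b) + sortedL1 θ b ≤ (1 / 2) * sqnorm (x - c) + sortedL1 θ c

/-- `‖v‖₀*` : the number of distinct nonzero magnitudes among the entries of `v`. -/
def numDistinctMags {p : ℕ} (v : Fin p → ℝ) : ℕ :=
  Set.ncard {r : ℝ | r ≠ 0 ∧ ∃ i, |v i| = r}

/-- matrix-vector product for a matrix given as rows of functions. -/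
def mulVec {n p : ℕ} (X : Fin n → Fin p → ℝ) (v : Fin p → ℝ) : Fin n → ℝ :=
  fun i => ∑ j, X i j * v j

/-- transpose matrix-vector product. -/
def mulVecT {n p : ℕ} (X : Fin n → Fin p → ℝ) (z : Fin n → ℝ) : Fin p → ℝ :=
  fun j => ∑ i, X i j * z i

/-- The SLOPE cost `C(b) = (1/2)‖y − Xb‖² + J_λ(b)`. -/
def slopeCost {n p : ℕ} (X : Fin n → Fin p → ℝ) (y : Fin n → ℝ) (lam b : Fin p → ℝ) : ℝ :=
  (1 / 2) * sqnorm (y - mulVec X b) + sortedL1 lam b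

lemma sqnorm_sub_smul {m : ℕ} (u d : Fin m → ℝ) (t : ℝ) :
    sqnorm (u - t • d) = sqnorm u - 2 * t * ∑ i, u i * d i + t ^ 2 * sqnorm d := by
  simp only [sqnorm, Finset.mul_sum, ← Finset.sum_add_distrib, ← Finset.sum_sub_distrib]
  refine Finset.sum_congr rfl fun i _ => ?_
  simp only [Pi.sub_apply, Pi.smul_apply, smul_eq_mul]
  ring

lemma sqnorm_nonneg {m : ℕ} (v : Fin m → ℝ) : 0 ≤ sqnorm v :=
  Finset.sum_nonneg fun _ _ => sq_nonneg _

lemma sum_mul_abs_le_sortedL1 {p : ℕ} (lam b : Fin p → ℝ) (σ : Equiv.Perm (Fin p)) :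
    ∑ i, lam i * |b (σ i)| ≤ sortedL1 lam b :=
  le_ciSup (f := fun σ : Equiv.Perm (Fin p) => ∑ i, lam i * |b (σ i)|)
    (Set.finite_range _).bddAbove σ

lemma sortedL1_smul {p : ℕ} (lam b : Fin p → ℝ) {k : ℝ} (hk : 0 ≤ k) :
    sortedL1 (k • lam) b = k * sortedL1 lam b := by
  simp only [sortedL1, Real.mul_iSup_of_nonneg hk, Finset.mul_sum, Pi.smul_apply, smul_eq_mul,
    mul_assoc]

lemma convexOn_sortedL1 {p : ℕ} {lam : Fin p → ℝ} (hlam : ∀ i, 0 ≤ lam i) :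
    ConvexOn ℝ Set.univ (sortedL1 lam) := by
  refine ⟨convex_univ, fun a _ b _ s t hs ht _ => ciSup_le fun σ => ?_⟩
  calc ∑ i, lam i * |(s • a + t • b) (σ i)|
      ≤ ∑ i, (s * (lam i * |a (σ i)|) + t * (lam i * |b (σ i)|)) := by
        refine Finset.sum_le_sum fun i _ => ?_
        have h : |s * a (σ i) + t * b (σ i)| ≤ s * |a (σ i)| + t * |b (σ i)| := by
          simpa only [abs_mul, abs_of_nonneg hs, abs_of_nonneg ht] using
            abs_add_le (s * a (σ i)) (t * b (σ i))
        calc lam i * |s * a (σ i) + t * b (σ i)|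
            ≤ lam i * (s * |a (σ i)| + t * |b (σ i)|) := mul_le_mul_of_nonneg_left h (hlam i)
          _ = _ := by ring
    _ = s * ∑ i, lam i * |a (σ i)| + t * ∑ i, lam i * |b (σ i)| := by
        rw [Finset.sum_add_distrib, Finset.mul_sum, Finset.mul_sum]
    _ ≤ s • sortedL1 lam a + t • sortedL1 lam b :=
        add_le_add (mul_le_mul_of_nonneg_left (sum_mul_abs_le_sortedL1 lam a σ) hs)
          (mul_le_mul_of_nonneg_left (sum_mul_abs_le_sortedL1 lam b σ) ht)

/-- If `b` is the proximal point at `b + u`, then `u` is a subgradient of the sorted ℓ1 norm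
at `b`. -/
lemma IsProx.subgradient {p : ℕ} {θ b u : Fin p → ℝ} (hθ : ∀ i, 0 ≤ θ i)
    (h : IsProx θ (b + u) b) (c : Fin p → ℝ) :
    sortedL1 θ b + ∑ i, u i * (c - b) i ≤ sortedL1 θ c := by
  have key : ∀ t : ℝ, 0 < t → t ≤ 1 →
      sortedL1 θ b + ∑ i, u i * (c - b) i ≤ sortedL1 θ c + t * (sqnorm (c - b) / 2) := by
    intro t ht ht1
    have hmin := h ((1 - t) • b + t • c)
    have hconv := (convexOn_sortedL1 hθ).2 (Set.mem_univ b) (Set.mem_univ c)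
      (sub_nonneg.2 ht1) ht.le (sub_add_cancel 1 t)
    have hsub : b + u - ((1 - t) • b + t • c) = u - t • (c - b) := by module
    rw [hsub, add_sub_cancel_left, sqnorm_sub_smul] at hmin
    simp only [smul_eq_mul] at hconv
    refine le_of_mul_le_mul_left ?_ ht
    linarith
  have hlim : Tendsto (fun t : ℝ => sortedL1 θ c + t * (sqnorm (c - b) / 2))
      (nhdsWithin 0 (Set.Ioi 0)) (nhds (sortedL1 θ c)) := by
    have hcont : Continuous fun t : ℝ => sortedL1 θ c + t * (sqnorm (c - b) / 2) := by fun_prop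
    simpa using (hcont.tendsto 0).mono_left nhdsWithin_le_nhds
  refine ge_of_tendsto hlim ?_
  filter_upwards [Ioc_mem_nhdsGT (zero_lt_one' ℝ)] with t ht
  exact key t ht.1 ht.2

lemma mulVec_sub {n p : ℕ} (X : Fin n → Fin p → ℝ) (a b : Fin p → ℝ) :
    mulVec X (a - b) = mulVec X a - mulVec X b := by
  ext i
  simp [mulVec, mul_sub]

lemma sum_mul_mulVec {n p : ℕ} (X : Fin n → Fin p → ℝ) (z : Fin n → ℝ) (d : Fin p → ℝ) :
    ∑ i, z i * mulVec X d i = ∑ j, mulVecT X z j * d j := by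
  simp only [mulVec, mulVecT, Finset.mul_sum, Finset.sum_mul]
  rw [Finset.sum_comm]
  exact Finset.sum_congr rfl fun _ _ => Finset.sum_congr rfl fun _ _ => by ring

/-- a stationary point `(β̂, ẑ)` of the SLOPE AMP iteration with
nonincreasing nonnegative thresholds `θ*` and `‖prox(β̂ + Xᵀẑ)‖₀* < n`
is a minimizer of the SLOPE cost with
`λ = θ*·(1 − (1/n)‖prox_{J_{θ*}}(β̂ + Xᵀẑ)‖₀*)`. -/
theorem statement1 {n p : ℕ} (hn : 0 < n)
    (X : Fin n → Fin p → ℝ) (y : Fin n → ℝ)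
    (θ : Fin p → ℝ) (hθmono : ∀ i j : Fin p, i ≤ j → θ j ≤ θ i)
    (hθnonneg : ∀ i, 0 ≤ θ i)
    (prox : (Fin p → ℝ) → Fin p → ℝ) (hprox : ∀ x, IsProx θ x (prox x))
    (βh : Fin p → ℝ) (zh : Fin n → ℝ)
    (hstat1 : βh = prox (βh + mulVecT X zh))
    (hstat2 : zh = y - mulVec X βh +
      ((numDistinctMags (prox (βh + mulVecT X zh)) : ℝ) / n) • zh)
    (hcount : numDistinctMags (prox (βh + mulVecT X zh)) < n) :
    ∀ b : Fin p → ℝ,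
      slopeCost X y ((1 - (numDistinctMags (prox (βh + mulVecT X zh)) : ℝ) / n) • θ) βh ≤
        slopeCost X y ((1 - (numDistinctMags (prox (βh + mulVecT X zh)) : ℝ) / n) • θ) b := by
  intro b
  have hprox' : IsProx θ (βh + mulVecT X zh) βh := by
    have h := hprox (βh + mulVecT X zh)
    rwa [← hstat1] at h
  have hsubgrad := hprox'.subgradient hθnonneg b
  have hk : 0 ≤ 1 - (numDistinctMags (prox (βh + mulVecT X zh)) : ℝ) / n := by
    rw [sub_nonneg, div_le_one (by exact_mod_cast hn)]
    exact_mod_cast hcount.le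
  have hres : y - mulVec X βh =
      (1 - (numDistinctMags (prox (βh + mulVecT X zh)) : ℝ) / n) • zh := by
    rw [sub_smul, one_smul]
    exact eq_sub_of_add_eq hstat2.symm
  generalize 1 - (numDistinctMags (prox (βh + mulVecT X zh)) : ℝ) / n = k at hk hres ⊢
  have hres_b : y - mulVec X b = k • zh - (1 : ℝ) • mulVec X (b - βh) := by
    rw [← hres, mulVec_sub, one_smul]
    abel
  have hinner : ∑ i, (k • zh) i * mulVec X (b - βh) i =
      k * ∑ j, mulVecT X zh j * (b - βh) j := by
    simp only [← sum_mul_mulVec, Finset.mul_sum, Pi.smul_apply, smul_eq_mul, mul_assoc]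
  unfold slopeCost
  rw [hres_b, hres, sqnorm_sub_smul, hinner, sortedL1_smul _ _ hk, sortedL1_smul _ _ hk]
  linarith [mul_le_mul_of_nonneg_left hsubgrad hk, sqnorm_nonneg (mulVec X (b - βh))]
end
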